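/- For every y ∈ ℝ, −Q′(y)·∫₀^y A(z)·Q(z)³ dz + A(y)·Q(y)⁴/4 = −Q(y)/2. -/

import Mathlib

open MeasureTheory

/-- The cubic NLS soliton profile. -/
noncomputable def Q (y : ℝ) : ℝ := Real.sqrt 2 / Real.cosh y

/-- The explicit odd-growth solution of the linearized equation. -/
noncomputable def A (y : ℝ) : ℝ :=
  (Real.sqrt 2 / (4 * Real.cosh y)) * (3 * y * Real.tanh y + (Real.sinh y) ^ 2 - 2)

theorem hasDerivAt_Q (y : ℝ) :
    HasDerivAt Q (-(Real.sqrt 2 * Real.sinh y) / Real.cosh y ^ 2) y := by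
  have h := (hasDerivAt_const y (Real.sqrt 2)).div (Real.hasDerivAt_cosh y)
    (Real.cosh_pos y).ne'
  exact h.congr_deriv (by simp)

theorem A_mul_Q_pow_three (z : ℝ) :
    A z * Q z ^ 3 =
      (3 * z * Real.sinh z / Real.cosh z + Real.sinh z ^ 2 - 2) / Real.cosh z ^ 4 := by
  have hc := (Real.cosh_pos z).ne'
  have h2 : Real.sqrt 2 ^ 4 = 4 := by
    rw [show Real.sqrt 2 ^ 4 = (Real.sqrt 2 ^ 2) ^ 2 by ring, Real.sq_sqrt (by norm_num)]
    norm_num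
  rw [A, Q, Real.tanh_eq_sinh_div_cosh]
  field_simp
  rw [h2]

theorem hasDerivAt_primitive_A_mul_Q_pow_three (z : ℝ) :
    HasDerivAt (fun z ↦ (-3 * z + 3 * Real.sinh z ^ 3 * Real.cosh z
      - 5 * Real.sinh z * Real.cosh z ^ 3) / (4 * Real.cosh z ^ 4)) (A z * Q z ^ 3) z := by
  have hc := (Real.cosh_pos z).ne'
  have hs := Real.hasDerivAt_sinh z
  have hd := Real.hasDerivAt_cosh z
  have h := (((((hasDerivAt_id z).const_mul (-3)).add (((hs.pow 3).const_mul 3).mul hd)).sub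
    ((hs.const_mul 5).mul (hd.pow 3))).div ((hd.pow 4).const_mul 4)
    (mul_ne_zero four_ne_zero (pow_ne_zero 4 hc)))
  refine h.congr_deriv ?_
  rw [A_mul_Q_pow_three]
  simp only [Pi.add_apply, Pi.sub_apply, Pi.mul_apply, Pi.pow_apply, id]
  have hsq := Real.sinh_sq z
  generalize Real.sinh z = s at *
  generalize Real.cosh z = c at *
  field_simp
  have h4 : s ^ 4 = (c ^ 2 - 1) ^ 2 := by rw [← hsq]; ring
  push_cast
  ring_nf
  simp only [hsq, h4]
  ring

theorem integral_A_mul_Q_pow_three (y : ℝ) :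
    ∫ z in (0:ℝ)..y, A z * Q z ^ 3 =
      (-3 * y + 3 * Real.sinh y ^ 3 * Real.cosh y - 5 * Real.sinh y * Real.cosh y ^ 3) /
        (4 * Real.cosh y ^ 4) := by
  have hcont : Continuous fun z ↦ A z * Q z ^ 3 := by
    simp only [A_mul_Q_pow_three]
    have hc (z : ℝ) : Real.cosh z ≠ 0 := (Real.cosh_pos z).ne'
    fun_prop (disch := simp [hc])
  rw [intervalIntegral.integral_eq_sub_of_hasDerivAt
    (fun z _ ↦ hasDerivAt_primitive_A_mul_Q_pow_three z) (hcont.intervalIntegrable 0 y)]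
  simp

theorem stmt9 :
    ∀ y : ℝ,
      -(deriv Q y) * (∫ z in (0:ℝ)..y, A z * (Q z) ^ 3) + A y * (Q y) ^ 4 / 4 = -(Q y) / 2 := by
  intro y
  have hc := (Real.cosh_pos y).ne'
  rw [(hasDerivAt_Q y).deriv, integral_A_mul_Q_pow_three,
    show A y * Q y ^ 4 = A y * Q y ^ 3 * Q y by ring, A_mul_Q_pow_three, Q]
  have hsq := Real.sinh_sq y
  generalize Real.sinh y = s at *
  generalize Real.cosh y = c at *
  field_simp
  have h4 : s ^ 4 = (c ^ 2 - 1) ^ 2 := by rw [← hsq]; ring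
  ring_nf
  simp only [hsq, h4]
  ring
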